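/- arXiv:1607.02276 — 2 statements merged into one kernel-verified Lean document; each statement's English description precedes it below -/
import Mathlib

section
/- Let L : ℝ × U × E → ℝ be a regular time dependent Lagrangian of class C², and let X : ℝ × U × E → ℝ × E × E be a vector field of the form X(v) = (1, X₁(v), X₂(v)) (so that i_X dt = 1). Then the 1-form i_XΩ_L is horizontal — that is, (i_XΩ_L)(v)(0,0,w) = 0 for every v ∈ ℝ × U × E and every w ∈ E — if and only if X₁(t,x,y) = y for all (t,x,y) ∈ ℝ × U × E, i.e. if and only if X is a time dependent semispray. -/
open Set

variable {E : Type*} [NormedAddCommGroup E] [NormedSpace ℝ E]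

/-- `∂₁L(t,x,y)`, partial derivative of the Lagrangian in the time variable. -/
noncomputable def d1L (L : ℝ → E → E → ℝ) (t : ℝ) (x y : E) : ℝ :=
  deriv (fun t' => L t' x y) t

/-- `∂₂L(t,x,y)`, partial Fréchet derivative of the Lagrangian in the base variable. -/
noncomputable def d2L (L : ℝ → E → E → ℝ) (t : ℝ) (x y : E) : E →L[ℝ] ℝ :=
  fderiv ℝ (fun x' => L t x' y) x

/-- `∂₃L(t,x,y)`, partial Fréchet derivative of the Lagrangian in the fiber variable. -/
noncomputable def d3L (L : ℝ → E → E → ℝ) (t : ℝ) (x y : E) : E →L[ℝ] ℝ :=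
  fderiv ℝ (fun y' => L t x y') y

/-- `d13L L t x y z` is `∂₁∂₃L(t,x,y)[z]`, the time derivative of `∂₃L(·,x,y)z`. -/
noncomputable def d13L (L : ℝ → E → E → ℝ) (t : ℝ) (x y : E) : E →L[ℝ] ℝ :=
  deriv (fun t' => d3L L t' x y) t

/-- `d23L L t x y a z` is `∂₂∂₃L(t,x,y)[z,a]`, the derivative in base direction `a` of
`∂₃L(t,·,y)z`. -/
noncomputable def d23L (L : ℝ → E → E → ℝ) (t : ℝ) (x y : E) : E →L[ℝ] E →L[ℝ] ℝ :=
  fderiv ℝ (fun x' => d3L L t x' y) x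

/-- `d33L L t x y w z` is `∂₃²L(t,x,y)[z,w]`, the derivative in fiber direction `w` of
`∂₃L(t,x,·)z`. -/
noncomputable def d33L (L : ℝ → E → E → ℝ) (t : ℝ) (x y : E) : E →L[ℝ] E →L[ℝ] ℝ :=
  fderiv ℝ (fun y' => d3L L t x y') y

/-- A time dependent Lagrangian `L` is regular on `U` if it is C² and at every point of
`ℝ × U × E` the map `X ↦ ∂₃²L(v)[·, X]` is a continuous linear isomorphism `E → E*`. -/
def RegularLagrangian (L : ℝ → E → E → ℝ) (U : Set E) : Prop :=
  ContDiffOn ℝ 2 (fun p : ℝ × E × E => L p.1 p.2.1 p.2.2) (univ ×ˢ U ×ˢ univ) ∧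
  ∀ t : ℝ, ∀ x ∈ U, ∀ y : E,
    ∃ e : E ≃L[ℝ] (E →L[ℝ] ℝ), ∀ X : E, e X = d33L L t x y X

/-- The fundamental 2-form `ω_L` of a time dependent Lagrangian (local expression). -/
noncomputable def omegaL (L : ℝ → E → E → ℝ) (t : ℝ) (x y : E) (u₁ u₂ : ℝ × E × E) : ℝ :=
  d13L L t x y u₁.2.1 * u₂.1 - d13L L t x y u₂.2.1 * u₁.1
    + d23L L t x y u₂.2.1 u₁.2.1 - d23L L t x y u₁.2.1 u₂.2.1
    + d33L L t x y u₂.2.2 u₁.2.1 - d33L L t x y u₁.2.2 u₂.2.1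

/-- The energy `E_L(t,x,y) = ∂₃L(t,x,y)y − L(t,x,y)`. -/
noncomputable def energyL (L : ℝ → E → E → ℝ) (t : ℝ) (x y : E) : ℝ :=
  d3L L t x y y - L t x y

/-- The Fréchet differential of the energy. -/
noncomputable def dEnergyL (L : ℝ → E → E → ℝ) (t : ℝ) (x y : E) : ℝ × E × E →L[ℝ] ℝ :=
  fderiv ℝ (fun p : ℝ × E × E => energyL L p.1 p.2.1 p.2.2) (t, x, y)

/-- `Ω_L = ω_L + dE_L ∧ dt` (local expression). -/
noncomputable def bigOmegaL (L : ℝ → E → E → ℝ) (t : ℝ) (x y : E) (u₁ u₂ : ℝ × E × E) : ℝ :=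
  omegaL L t x y u₁ u₂ + dEnergyL L t x y u₁ * u₂.1 - dEnergyL L t x y u₂ * u₁.1

/-- The fiber derivative is the full derivative restricted to the fiber direction. -/
theorem d3L_eq_fderiv_comp {L : ℝ → E → E → ℝ} {t : ℝ} {x y : E}
    (h : DifferentiableAt ℝ (fun p : ℝ × E × E => L p.1 p.2.1 p.2.2) (t, x, y)) :
    d3L L t x y = (fderiv ℝ (fun p : ℝ × E × E => L p.1 p.2.1 p.2.2) (t, x, y)).comp
      ((ContinuousLinearMap.inr ℝ ℝ (E × E)).comp (ContinuousLinearMap.inr ℝ E E)) := by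
  have hi : HasFDerivAt (fun y' : E => ((t, x, y') : ℝ × E × E))
      ((ContinuousLinearMap.inr ℝ ℝ (E × E)).comp (ContinuousLinearMap.inr ℝ E E)) y :=
    (hasFDerivAt_prodMk_right t (x, y)).comp y (hasFDerivAt_prodMk_right x y)
  exact (HasFDerivAt.comp (g := fun p : ℝ × E × E => L p.1 p.2.1 p.2.2) y
    h.hasFDerivAt hi).fderiv

/-- The fiber derivative of a C² Lagrangian is differentiable. -/
theorem differentiableAt_d3L {L : ℝ → E → E → ℝ} {v : ℝ × E × E}
    (h : ContDiffAt ℝ 2 (fun p : ℝ × E × E => L p.1 p.2.1 p.2.2) v) :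
    DifferentiableAt ℝ (fun p : ℝ × E × E => d3L L p.1 p.2.1 p.2.2) v := by
  have hd : DifferentiableAt ℝ (fderiv ℝ (fun p : ℝ × E × E => L p.1 p.2.1 p.2.2)) v :=
    (h.fderiv_right (m := 1) (by norm_num)).differentiableAt (by norm_num)
  refine (hd.clm_comp (differentiableAt_const
    ((ContinuousLinearMap.inr ℝ ℝ (E × E)).comp
      (ContinuousLinearMap.inr ℝ E E)))).congr_of_eventuallyEq ?_
  filter_upwards [h.eventually (by simp)] with p hp
  exact d3L_eq_fderiv_comp (hp.differentiableAt (by norm_num))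

/-- The differential of the energy in a fiber direction `w` is `∂₃²L(t,x,y)[y,w]`. -/
theorem dEnergyL_fiber {L : ℝ → E → E → ℝ} {t : ℝ} {x y : E}
    (h : ContDiffAt ℝ 2 (fun p : ℝ × E × E => L p.1 p.2.1 p.2.2) (t, x, y)) (w : E) :
    dEnergyL L t x y (0, 0, w) = d33L L t x y w y := by
  have hL : DifferentiableAt ℝ (fun p : ℝ × E × E => L p.1 p.2.1 p.2.2) (t, x, y) :=
    h.differentiableAt (by norm_num)
  have hd := differentiableAt_d3L h
  have hE : DifferentiableAt ℝ (fun p : ℝ × E × E => energyL L p.1 p.2.1 p.2.2) (t, x, y) :=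
    (hd.clm_apply (by fun_prop)).sub hL
  have hi : HasFDerivAt (fun y' : E => ((t, x, y') : ℝ × E × E))
      ((ContinuousLinearMap.inr ℝ ℝ (E × E)).comp (ContinuousLinearMap.inr ℝ E E)) y :=
    (hasFDerivAt_prodMk_right t (x, y)).comp y (hasFDerivAt_prodMk_right x y)
  have hLy : HasFDerivAt (fun y' => L t x y') (d3L L t x y) y :=
    (DifferentiableAt.comp (g := fun p : ℝ × E × E => L p.1 p.2.1 p.2.2) y
      hL hi.differentiableAt).hasFDerivAt
  have hdy : HasFDerivAt (fun y' => d3L L t x y') (d33L L t x y) y :=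
    (DifferentiableAt.comp (g := fun p : ℝ × E × E => d3L L p.1 p.2.1 p.2.2) y
      hd hi.differentiableAt).hasFDerivAt
  have hEy := HasFDerivAt.comp (g := fun p : ℝ × E × E => energyL L p.1 p.2.1 p.2.2) y
    hE.hasFDerivAt hi
  have key := congrArg (fun T : E →L[ℝ] ℝ => T w)
    (hEy.unique ((hdy.clm_apply (hasFDerivAt_id y)).sub hLy))
  simpa [dEnergyL] using key

/-- `(i_X Ω_L)(0,0,w) = ∂₃²L(v)[X₁ - y, w]` for a vector field `X = (1, X₁, X₂)`. -/
theorem bigOmegaL_fiber {L : ℝ → E → E → ℝ} {t : ℝ} {x y : E}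
    (h : ContDiffAt ℝ 2 (fun p : ℝ × E × E => L p.1 p.2.1 p.2.2) (t, x, y)) (a b w : E) :
    bigOmegaL L t x y (1, a, b) (0, 0, w) = d33L L t x y w (a - y) := by
  simp [bigOmegaL, omegaL, dEnergyL_fiber h]

/-- For a regular time dependent Lagrangian and a vector field
`X = (1, X₁, X₂)` (so `i_X dt = 1`), the 1-form `i_X Ω_L` is horizontal iff `X₁(t,x,y)=y`,
i.e. iff `X` is a time dependent semispray. -/
theorem iX_bigOmega_horizontal_iff_semispray
    {E : Type*} [NormedAddCommGroup E] [NormedSpace ℝ E] [CompleteSpace E]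
    (U : Set E) (hU : IsOpen U) (L : ℝ → E → E → ℝ)
    (hreg : RegularLagrangian L U)
    (X₁ X₂ : ℝ → E → E → E) :
    (∀ t : ℝ, ∀ x ∈ U, ∀ y : E, ∀ w : E,
        bigOmegaL L t x y (1, X₁ t x y, X₂ t x y) ((0 : ℝ), (0 : E), w) = 0)
      ↔ (∀ t : ℝ, ∀ x ∈ U, ∀ y : E, X₁ t x y = y) := by
  have hC : ∀ t : ℝ, ∀ x ∈ U, ∀ y : E,
      ContDiffAt ℝ 2 (fun p : ℝ × E × E => L p.1 p.2.1 p.2.2) (t, x, y) := fun t x hx y =>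
    hreg.1.contDiffAt ((isOpen_univ.prod (hU.prod isOpen_univ)).mem_nhds
      ⟨mem_univ _, hx, mem_univ _⟩)
  refine forall_congr' fun t => forall₂_congr fun x hx => forall_congr' fun y => ?_
  simp only [bigOmegaL_fiber (hC t x hx y)]
  refine ⟨fun h0 => ?_, fun h0 w => by simp [h0]⟩
  obtain ⟨e, he⟩ := hreg.2 t x hx y
  rw [← sub_eq_zero]
  refine SeparatingDual.eq_zero_of_forall_dual_eq_zero (R := ℝ) fun f => ?_
  obtain ⟨w, rfl⟩ := e.surjective f
  rw [he]
  exact h0 w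
end

section
/- Let L : ℝ × U × E → ℝ be a regular time dependent Lagrangian of class C² with canonical semispray coefficient Z₂, and let Y(v) = (0, 0, Y₂(v)) be a vertical vector field on ℝ × U × E. Then a vector field X(v) = (1, X₁(v), X₂(v)) satisfies (i_XΩ_L)(v)(0, z, w) = (i_Yω_L)(v)(0, z, w) for all v ∈ ℝ × U × E and all (z,w) ∈ E × E if and only if X₁(t,x,y) = y and X₂(v) = Z₂(v) + Y₂(v) for all v = (t,x,y) ∈ ℝ × U × E; that is, X is the sum of the Lagrangian semispray determined by L and the vertical vector field Y. -/
open Set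

variable {E : Type*} [NormedAddCommGroup E] [NormedSpace ℝ E]

theorem hasFDerivAt_base_inclusion (t : ℝ) (x y : E) :
    HasFDerivAt (fun x' : E => ((t, x', y) : ℝ × E × E))
      (ContinuousLinearMap.inr ℝ ℝ (E × E) ∘L ContinuousLinearMap.inl ℝ E E) x :=
  (hasFDerivAt_prodMk_right t (x, y)).comp x (hasFDerivAt_prodMk_left x y)

theorem hasFDerivAt_fiber_inclusion (t : ℝ) (x y : E) :
    HasFDerivAt (fun y' : E => ((t, x, y') : ℝ × E × E))
      (ContinuousLinearMap.inr ℝ ℝ (E × E) ∘L ContinuousLinearMap.inr ℝ E E) y :=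
  (hasFDerivAt_prodMk_right t (x, y)).comp y (hasFDerivAt_prodMk_right x y)

/-- `∂₃L` is differentiable in all variables jointly when `L` is C². -/
theorem differentiableAt_d3L_s13 {U : Set E} (hU : IsOpen U) {L : ℝ → E → E → ℝ}
    (hL : ContDiffOn ℝ 2 (fun p : ℝ × E × E => L p.1 p.2.1 p.2.2) (univ ×ˢ U ×ˢ univ))
    (t : ℝ) {x : E} (hx : x ∈ U) (y : E) :
    DifferentiableAt ℝ (fun p : ℝ × E × E => d3L L p.1 p.2.1 p.2.2) (t, x, y) := by
  have hopen : IsOpen ((univ : Set ℝ) ×ˢ U ×ˢ (univ : Set E)) :=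
    isOpen_univ.prod (hU.prod isOpen_univ)
  have hmem : ((t, x, y) : ℝ × E × E) ∈ (univ : Set ℝ) ×ˢ U ×ˢ (univ : Set E) := by
    simp [hx]
  have hd : DifferentiableAt ℝ
      (fderiv ℝ (fun p : ℝ × E × E => L p.1 p.2.1 p.2.2)) (t, x, y) :=
    ((hL.fderiv_of_isOpen (m := 1) hopen (by norm_num)).differentiableOn
      one_ne_zero).differentiableAt (hopen.mem_nhds hmem)
  refine (hd.clm_comp (differentiableAt_const
    (ContinuousLinearMap.inr ℝ ℝ (E × E) ∘L ContinuousLinearMap.inr ℝ E E))).congr_of_eventuallyEq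
      ?_
  filter_upwards [hopen.mem_nhds hmem] with p hp
  exact (((hL.differentiableOn two_ne_zero).differentiableAt (hopen.mem_nhds hp)).hasFDerivAt.comp
    p.2.2 (hasFDerivAt_fiber_inclusion p.1 p.2.1 p.2.2)).fderiv

/-- The differential of the energy in directions without time component. -/
theorem dEnergyL_apply_zero {U : Set E} (hU : IsOpen U) {L : ℝ → E → E → ℝ}
    (hL : ContDiffOn ℝ 2 (fun p : ℝ × E × E => L p.1 p.2.1 p.2.2) (univ ×ˢ U ×ˢ univ))
    (t : ℝ) {x : E} (hx : x ∈ U) (y z w : E) :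
    dEnergyL L t x y (0, z, w) = d23L L t x y z y + d33L L t x y w y - d2L L t x y z := by
  have hopen : IsOpen ((univ : Set ℝ) ×ˢ U ×ˢ (univ : Set E)) :=
    isOpen_univ.prod (hU.prod isOpen_univ)
  have hmem : ((t, x, y) : ℝ × E × E) ∈ (univ : Set ℝ) ×ˢ U ×ˢ (univ : Set E) := by
    simp [hx]
  have hF := ((hL.differentiableOn two_ne_zero).differentiableAt
    (hopen.mem_nhds hmem)).hasFDerivAt
  have hG := (differentiableAt_d3L_s13 hU hL t hx y).hasFDerivAt
  have h2 := (hF.comp x (hasFDerivAt_base_inclusion t x y)).fderiv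
  have h3 := (hF.comp y (hasFDerivAt_fiber_inclusion t x y)).fderiv
  have h23 := (hG.comp x (hasFDerivAt_base_inclusion t x y)).fderiv
  have h33 := (hG.comp y (hasFDerivAt_fiber_inclusion t x y)).fderiv
  change d2L L t x y = _ at h2
  change d3L L t x y = _ at h3
  change d23L L t x y = _ at h23
  change d33L L t x y = _ at h33
  have hE := ((hG.clm_apply (hasFDerivAt_snd.comp (t, x, y) hasFDerivAt_snd)).sub hF).fderiv
  change dEnergyL L t x y = _ at hE
  have hsplit : ((0, z, w) : ℝ × E × E) = (0, z, 0) + (0, 0, w) := by simp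
  rw [hE, h2, h23, h33]
  simp only [h3, sub_apply, add_apply,
    ContinuousLinearMap.comp_apply, ContinuousLinearMap.flip_apply, Function.comp_apply,
    ContinuousLinearMap.coe_snd', ContinuousLinearMap.inl_apply,
    ContinuousLinearMap.inr_apply]
  rw [hsplit]
  simp only [map_add, add_apply]
  ring

/-- For a regular time dependent Lagrangian with canonical semispray
coefficient `Z₂` and a vertical field `Y = (0,0,Y₂)`, a vector field `X = (1, X₁, X₂)`
satisfies `(i_XΩ_L)(v)(0,z,w) = (i_Yω_L)(v)(0,z,w)` iff `X₁ = y` and `X₂ = Z₂ + Y₂`,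
i.e. iff `X` is the Lagrangian semispray plus the vertical force field. -/
theorem semispray_with_external_force_characterization
    {E : Type*} [NormedAddCommGroup E] [NormedSpace ℝ E] [CompleteSpace E]
    (U : Set E) (hU : IsOpen U) (L : ℝ → E → E → ℝ)
    (hreg : RegularLagrangian L U)
    (Z₂ : ℝ → E → E → E)
    (hZ₂ : ∀ t : ℝ, ∀ x ∈ U, ∀ y z : E,
      d33L L t x y (Z₂ t x y) z
        = d2L L t x y z - d13L L t x y z - d23L L t x y y z)
    (Y₂ X₁ X₂ : ℝ → E → E → E) :
    (∀ t : ℝ, ∀ x ∈ U, ∀ y : E, ∀ z w : E,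
        bigOmegaL L t x y (1, X₁ t x y, X₂ t x y) ((0 : ℝ), z, w)
          = omegaL L t x y ((0 : ℝ), (0 : E), Y₂ t x y) ((0 : ℝ), z, w))
      ↔ (∀ t : ℝ, ∀ x ∈ U, ∀ y : E,
          X₁ t x y = y ∧ X₂ t x y = Z₂ t x y + Y₂ t x y) := by
  have key : ∀ t : ℝ, ∀ x ∈ U, ∀ y z w : E,
      bigOmegaL L t x y (1, X₁ t x y, X₂ t x y) ((0 : ℝ), z, w)
          - omegaL L t x y ((0 : ℝ), (0 : E), Y₂ t x y) ((0 : ℝ), z, w)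
        = d23L L t x y z (X₁ t x y - y) - d23L L t x y (X₁ t x y - y) z
          + d33L L t x y w (X₁ t x y - y)
          + d33L L t x y (Z₂ t x y + Y₂ t x y - X₂ t x y) z := by
    intro t x hx y z w
    have hZ := hZ₂ t x hx y z
    simp only [bigOmegaL, omegaL, dEnergyL_apply_zero hU hreg.1 t hx y z w, map_sub, map_add,
      map_zero, sub_apply, add_apply,
      zero_apply]
    linarith
  constructor
  · intro h t x hx y
    obtain ⟨e, he⟩ := hreg.2 t x hx y
    have hzero := fun z w => (key t x hx y z w).symm.trans (sub_eq_zero.2 (h t x hx y z w))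
    have h₁ : X₁ t x y - y = 0 := by
      refine SeparatingDual.eq_zero_of_forall_dual_eq_zero (R := ℝ) fun f => ?_
      have := hzero 0 (e.symm f)
      simpa [-map_sub, ← he] using this
    refine ⟨sub_eq_zero.1 h₁, ?_⟩
    have h₂ : e (Z₂ t x y + Y₂ t x y - X₂ t x y) = 0 := by
      ext z
      have := hzero z 0
      rw [h₁] at this
      simpa [-map_sub, -map_add, he] using this
    exact (sub_eq_zero.1 (e.map_eq_zero_iff.1 h₂)).symm
  · intro h t x hx y z w
    obtain ⟨h₁, h₂⟩ := h t x hx y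
    rw [← sub_eq_zero, key t x hx y z w, h₁, h₂]
    simp
end
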